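/- Let q be a prime power, F the finite field with q elements, n ≥ 2 an integer, and δ ∈ [0,(q-1)/q). Suppose R_LRC(·,n) : [0,(q-1)/q] → ℝ is a function such that, for every δ' ∈ [0,(q-1)/q], the rate of every all-disjoint linearly recoverable (δ',n)-LRC sequence over F is at most R_LRC(δ',n). Then the rate R of every all-disjoint linearly recoverable (δ,n)-LRC sequence over F satisfies R ≤ R_1(δ,n) := inf over τ ∈ (0,1) and over pairs (θ,θ') ∈ [0,(q-1)/q]² with τ·θ + (1-τ)·θ' = δ of the quantity τ·R_0(θ/2,n) + (1-τ)·R_LRC(θ',n). -/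

import Mathlib

open Filter Set

noncomputable section

/-- Minimum (Hamming) distance of a code: the least Hamming distance between two
distinct codewords. -/
def minDist {K : Type} [DecidableEq K] {ι : Type} [Fintype ι] (C : Set (ι → K)) : ℕ :=
  sInf {d : ℕ | ∃ c ∈ C, ∃ c' ∈ C, c ≠ c' ∧ hammingDist c c' = d}

/-- `Rg` is a list of repair groups (one for each coordinate) exhibiting the code `C`
as a *linearly recoverable* locally repairable code with locality `n - 1`:
each repair group contains its coordinate, has size at most `n`, and the value of a
codeword at the coordinate is recovered by an `F`-linear function of its values on the
rest of the repair group. -/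
def IsLinRecLRC {K : Type} [Field K] {N : ℕ} (C : Set (Fin N → K)) (n : ℕ)
    (Rg : Fin N → Finset (Fin N)) : Prop :=
  ∀ j : Fin N, j ∈ Rg j ∧ (Rg j).card ≤ n ∧
    ∃ a : Fin N → K, (∀ i, i ∉ (Rg j).erase j → a i = 0) ∧
      ∀ c ∈ C, c j = ∑ i, a i * c i

/-- The distinct members of the list of repair groups `Rg` form a partition of the set of
coordinates (any two repair groups in the list are equal or disjoint; they cover all
coordinates since each `Rg j` contains `j`). -/
def IsAllDisjoint {N : ℕ} (Rg : Fin N → Finset (Fin N)) : Prop :=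
  ∀ j j' : Fin N, Rg j = Rg j' ∨ Disjoint (Rg j) (Rg j')

/-- `λ_q(ω,n)`. -/
def lambdaQ (q : ℕ) (ω : ℝ) (n : ℕ) : ℝ :=
  ⨅ z : Set.Ioc (0:ℝ) 1,
    (-ω * Real.logb q (z : ℝ) - 1 / n +
      (1 / n) * Real.logb q ((1 + ((q:ℝ) - 1) * (z:ℝ)) ^ n + ((q:ℝ) - 1) * (1 - (z:ℝ)) ^ n))

/-- `R_0(ω,n) = (n-1)/n - λ_q(ω,n)`. -/
def R0 (q : ℕ) (ω : ℝ) (n : ℕ) : ℝ := ((n:ℝ) - 1) / n - lambdaQ q ω n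


lemma sum_mul_update {K ι : Type} [Field K] [DecidableEq ι] {g : Finset ι} {i : ι} (hi : i ∉ g)
    (d x : ι → K) (y : K) :
    ∑ k ∈ g, d k * Function.update x i y k = ∑ k ∈ g, d k * x k :=
  Finset.sum_congr rfl fun k hk => by
    rw [Function.update_of_ne (ne_of_mem_of_not_mem hk hi)]

lemma hammingNorm_update {K ι : Type} [Field K] [DecidableEq K] [Fintype ι] [DecidableEq ι]
    {x : ι → K} {i : ι} (hx : x i = 0) (y : K) :
    hammingNorm (Function.update x i y) = hammingNorm x + if y = 0 then 0 else 1 := by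
  unfold hammingNorm
  split_ifs with h
  · rw [h, ← hx, Function.update_eq_self, add_zero]
  · have : (Finset.univ.filter fun k => Function.update x i y k ≠ 0)
        = insert i (Finset.univ.filter fun k => x k ≠ 0) := by
      ext k
      by_cases hk : k = i
      · subst hk; simp [h]
      · simp [hk]
    rw [this, Finset.card_insert_of_notMem (by simp [hx])]

section Codes
variable {K ι : Type} [Field K] [Fintype K] [DecidableEq K] [Fintype ι] [DecidableEq ι]

/-- The words supported in `g`. -/
def suppIn (K : Type) [Field K] [Fintype K] [DecidableEq K] (g : Finset ι) : Finset (ι → K) :=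
  Finset.univ.filter fun x => ∀ i, i ∉ g → x i = 0

/-- The words supported in `g` that satisfy the parity check `d` on `g`. -/
def parityCode (g : Finset ι) (d : ι → K) : Finset (ι → K) :=
  Finset.univ.filter fun x => (∀ i, i ∉ g → x i = 0) ∧ ∑ i ∈ g, d i * x i = 0

/-- The words supported in the union of the sets in `G` that satisfy the parity check `d g` on
each `g ∈ G`. -/
def productCode (G : Finset (Finset ι)) (d : Finset ι → ι → K) : Finset (ι → K) :=
  Finset.univ.filter fun x =>
    (∀ i, (∀ g ∈ G, i ∉ g) → x i = 0) ∧ ∀ g ∈ G, ∑ i ∈ g, d g i * x i = 0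

lemma sum_suppIn_insert {g : Finset ι} {i : ι} (hi : i ∉ g) (f : (ι → K) → ℝ) :
    ∑ x ∈ suppIn K (insert i g), f x
      = ∑ x ∈ suppIn K g, ∑ y : K, f (Function.update x i y) := by
  rw [← Finset.sum_product']
  refine Finset.sum_nbij' (fun x => (Function.update x i 0, x i))
    (fun p => Function.update p.1 i p.2) ?_ ?_ ?_ ?_ ?_
  · intro x hx
    simp only [suppIn, Finset.mem_filter, Finset.mem_univ, true_and, Finset.mem_product,
      and_true] at hx ⊢
    intro k hk
    by_cases h : k = i
    · subst h; simp
    · rw [Function.update_of_ne h]; exact hx k (by simp [h, hk])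
  · intro p hp
    simp only [suppIn, Finset.mem_filter, Finset.mem_univ, true_and, Finset.mem_product,
      and_true, Finset.mem_insert, not_or] at hp ⊢
    intro k hk
    rw [Function.update_of_ne hk.1]; exact hp k hk.2
  · intro x _; simp
  · intro p hp
    simp only [suppIn, Finset.mem_filter, Finset.mem_univ, true_and, Finset.mem_product,
      and_true] at hp
    have h0 := hp i hi
    ext k
    · by_cases h : k = i
      · subst h; simp [h0]
      · simp [h]
    · simp
  · intro x _; simp

lemma sum_pow_indicator (z : ℝ) :
    ∑ y : K, z ^ (if y = 0 then 0 else 1) = 1 + ((Fintype.card K : ℝ) - 1) * z := by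
  rw [← Finset.add_sum_erase _ _ (Finset.mem_univ (0 : K))]
  rw [Finset.sum_congr rfl (g := fun _ => z) (fun y hy => by simp [Finset.ne_of_mem_erase hy])]
  have : 1 ≤ Fintype.card K := Fintype.card_pos
  simp [Finset.card_erase_of_mem, Nat.cast_sub this]

lemma sum_suppIn_pow (g : Finset ι) (z : ℝ) :
    ∑ x ∈ suppIn K g, z ^ hammingNorm x = (1 + ((Fintype.card K : ℝ) - 1) * z) ^ g.card := by
  induction g using Finset.induction_on with
  | empty =>
    have : suppIn K (∅ : Finset ι) = {0} := by
      ext x; simp [suppIn, funext_iff]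
    simp [this]
  | insert i g hi ih =>
    rw [sum_suppIn_insert hi, Finset.card_insert_of_notMem hi, pow_succ, ← ih, Finset.sum_mul]
    refine Finset.sum_congr rfl fun x hx => ?_
    have h0 : x i = 0 := (Finset.mem_filter.1 hx).2 i hi
    simp_rw [hammingNorm_update h0, pow_add]
    rw [← Finset.mul_sum, sum_pow_indicator]

lemma sum_parityCode (g : Finset ι) (d : ι → K) (f : (ι → K) → ℝ) :
    ∑ x ∈ parityCode g d, f x
      = ∑ x ∈ suppIn K g, if ∑ i ∈ g, d i * x i = 0 then f x else 0 := by
  rw [← Finset.sum_filter, parityCode, suppIn, Finset.filter_filter]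

lemma sum_parityCode_insert_ne {g : Finset ι} {i : ι} (hi : i ∉ g) {d : ι → K} (hd : d i ≠ 0)
    (z : ℝ) :
    ∑ x ∈ parityCode (insert i g) d, z ^ hammingNorm x
      = (1 - z) * ∑ x ∈ parityCode g d, z ^ hammingNorm x
        + z * ∑ x ∈ suppIn K g, z ^ hammingNorm x := by
  rw [sum_parityCode, sum_parityCode, sum_suppIn_insert hi, Finset.mul_sum, Finset.mul_sum,
    ← Finset.sum_add_distrib]
  refine Finset.sum_congr rfl fun x hx => ?_
  have h0 : x i = 0 := (Finset.mem_filter.1 hx).2 i hi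
  simp_rw [Finset.sum_insert hi, sum_mul_update hi, hammingNorm_update h0, Function.update_self]
  set s := ∑ k ∈ g, d k * x k
  have key : ∀ y : K, d i * y + s = 0 ↔ y = -s / d i := by
    intro y
    rw [eq_div_iff hd]
    constructor
    · intro h; linear_combination h
    · intro h; linear_combination h
  simp_rw [key]
  rw [Finset.sum_ite_eq' Finset.univ (-s / d i)]
  by_cases hs : s = 0
  · simp [hs]; ring
  · simp [hs, hd, pow_succ]; ring

lemma sum_parityCode_insert_eq {g : Finset ι} {i : ι} (hi : i ∉ g) {d : ι → K} (hd : d i = 0)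
    (z : ℝ) :
    ∑ x ∈ parityCode (insert i g) d, z ^ hammingNorm x
      = (1 + ((Fintype.card K : ℝ) - 1) * z) * ∑ x ∈ parityCode g d, z ^ hammingNorm x := by
  rw [sum_parityCode, sum_parityCode, sum_suppIn_insert hi, Finset.mul_sum]
  refine Finset.sum_congr rfl fun x hx => ?_
  have h0 : x i = 0 := (Finset.mem_filter.1 hx).2 i hi
  simp_rw [Finset.sum_insert hi, sum_mul_update hi, hammingNorm_update h0, hd, zero_mul, zero_add,
    pow_add]
  split_ifs
  · rw [← Finset.mul_sum, sum_pow_indicator, mul_comm]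
  · simp

/-- Lower bound for the weight enumerator of a parity-check code. -/
lemma le_sum_parityCode (g : Finset ι) (d : ι → K) {z : ℝ} (hz0 : 0 ≤ z) (hz1 : z ≤ 1) :
    (1 + ((Fintype.card K : ℝ) - 1) * z) ^ g.card + ((Fintype.card K : ℝ) - 1) * (1 - z) ^ g.card
      ≤ Fintype.card K * ∑ x ∈ parityCode g d, z ^ hammingNorm x := by
  have hq : (1 : ℝ) ≤ Fintype.card K := by exact_mod_cast Fintype.card_pos (α := K)
  induction g using Finset.induction_on with
  | empty =>
    have : parityCode (∅ : Finset ι) d = {0} := by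
      ext x; simp [parityCode, funext_iff]
    simp [this]
  | insert i g hi ih =>
    rw [Finset.card_insert_of_notMem hi]
    set q : ℝ := (Fintype.card K : ℝ)
    have hB : 0 ≤ (1 - z) := by linarith
    have hA : 1 - z ≤ 1 + (q - 1) * z := by nlinarith
    by_cases hd : d i = 0
    · rw [sum_parityCode_insert_eq hi hd]
      have h1 := mul_le_mul_of_nonneg_left ih (hB.trans hA)
      have h2 : (q - 1) * (1 - z) ^ g.card * (1 - z)
          ≤ (q - 1) * (1 - z) ^ g.card * (1 + (q - 1) * z) :=
        mul_le_mul_of_nonneg_left hA (mul_nonneg (by linarith) (pow_nonneg hB _))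
      rw [pow_succ, pow_succ]
      linarith
    · rw [sum_parityCode_insert_ne hi hd, sum_suppIn_pow]
      have h1 := mul_le_mul_of_nonneg_left ih hB
      rw [pow_succ, pow_succ]
      linarith

lemma card_parityCode {g : Finset ι} {d : ι → K} {i : ι} (hi : i ∈ g) (hd : d i ≠ 0) :
    ((parityCode g d).card : ℝ) = (Fintype.card K : ℝ) ^ (g.card - 1) := by
  have h := sum_parityCode_insert_ne (Finset.notMem_erase i g) hd 1
  rw [Finset.insert_erase hi, sum_suppIn_pow, Finset.card_erase_of_mem hi] at h
  simpa using h

lemma hammingNorm_le_of_mem_parityCode {g : Finset ι} {d x : ι → K} (hx : x ∈ parityCode g d) :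
    hammingNorm x ≤ g.card := by
  refine Finset.card_le_card fun i hi => ?_
  by_contra h
  exact (Finset.mem_filter.1 hi).2 ((Finset.mem_filter.1 hx).2.1 i h)

lemma productCode_insert {G : Finset (Finset ι)} {g : Finset ι}
    (hdisj : ∀ h ∈ G, Disjoint g h) (d : Finset ι → ι → K) (z : ℝ) :
    ∑ x ∈ productCode (insert g G) d, z ^ hammingNorm x
      = (∑ x ∈ parityCode g (d g), z ^ hammingNorm x) *
        ∑ x ∈ productCode G d, z ^ hammingNorm x := by
  rw [Finset.sum_mul_sum, ← Finset.sum_product']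
  have hnot : ∀ h ∈ G, ∀ i ∈ h, i ∉ g := fun h hh i hi hig =>
    Finset.disjoint_left.1 (hdisj h hh) hig hi
  refine Finset.sum_nbij' (fun x => (fun i => if i ∈ g then x i else 0,
    fun i => if i ∈ g then 0 else x i)) (fun p => p.1 + p.2) ?_ ?_ ?_ ?_ ?_
  · intro x hx
    simp only [productCode, parityCode, Finset.mem_filter, Finset.mem_univ, true_and,
      Finset.mem_product, Finset.forall_mem_insert] at hx ⊢
    refine ⟨⟨fun i hi => by simp [hi], ?_⟩, ?_, ?_⟩
    · rw [← hx.2.1]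
      exact Finset.sum_congr rfl fun i hi => by simp [hi]
    · intro i hi
      by_cases h : i ∈ g
      · simp [h]
      · simpa [h] using hx.1 i ⟨h, hi⟩
    · intro h hh
      rw [← hx.2.2 h hh]
      exact Finset.sum_congr rfl fun i hi => by simp [hnot h hh i hi]
  · rintro ⟨x, y⟩ hp
    simp only [productCode, parityCode, Finset.mem_filter, Finset.mem_univ, true_and,
      Finset.mem_product, Finset.forall_mem_insert] at hp ⊢
    obtain ⟨⟨hx1, hx2⟩, hy1, hy2⟩ := hp
    refine ⟨fun i hi => by simp [hx1 i hi.1, hy1 i hi.2], ?_, ?_⟩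
    · rw [← hx2]
      refine Finset.sum_congr rfl fun i hi => ?_
      simp [hy1 i fun h hh hih => hnot h hh i hih hi]
    · intro h hh
      rw [← hy2 h hh]
      refine Finset.sum_congr rfl fun i hi => ?_
      simp [hx1 i (hnot h hh i hi)]
  · intro x _
    ext i
    by_cases h : i ∈ g <;> simp [h]
  · rintro ⟨x, y⟩ hp
    simp only [productCode, parityCode, Finset.mem_filter, Finset.mem_univ, true_and,
      Finset.mem_product] at hp
    obtain ⟨⟨hx1, hx2⟩, hy1, hy2⟩ := hp
    have hy : ∀ i ∈ g, y i = 0 := fun i hi => hy1 i fun h hh hih => hnot h hh i hih hi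
    ext i
    · by_cases h : i ∈ g <;> simp [h, hx1, hy]
    · by_cases h : i ∈ g <;> simp [h, hx1, hy]
  · intro x _
    rw [← pow_add]
    congr 1
    unfold hammingNorm
    rw [← Finset.card_filter_add_card_filter_not (s := Finset.univ.filter fun i => x i ≠ 0) (· ∈ g)]
    congr 1
    · congr 1; ext i; simp [and_comm]
    · congr 1; ext i; simp [and_comm]

lemma sum_productCode {G : Finset (Finset ι)} (hG : (G : Set (Finset ι)).PairwiseDisjoint id)
    (d : Finset ι → ι → K) (z : ℝ) :
    ∑ x ∈ productCode G d, z ^ hammingNorm x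
      = ∏ g ∈ G, ∑ x ∈ parityCode g (d g), z ^ hammingNorm x := by
  induction G using Finset.induction_on with
  | empty =>
    have : productCode (∅ : Finset (Finset ι)) d = {0} := by
      ext x; simp [productCode, funext_iff]
    simp [this]
  | insert g G hg ih =>
    rw [Finset.coe_insert, Set.pairwiseDisjoint_insert_of_notMem (by simpa using hg)] at hG
    rw [Finset.prod_insert hg, ← ih hG.1]
    exact productCode_insert hG.2 d z

end Codes

section Tails

/-- A bound for the exponential moments of a tilted weight distribution. -/
lemma sum_pow_mul_exp_le {β : Type} (Ω : Finset β) (X : β → ℕ) {n : ℕ} (hX : ∀ x ∈ Ω, X x ≤ n)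
    {z : ℝ} (hz : 0 < z) (hΩ : Ω.Nonempty) {t : ℝ} (ht : |t| * n ≤ 1) :
    ∑ x ∈ Ω, (z * Real.exp t) ^ X x
      ≤ (∑ x ∈ Ω, z ^ X x) *
        Real.exp (t * ((∑ x ∈ Ω, X x * z ^ X x) / ∑ x ∈ Ω, z ^ X x) + t ^ 2 * n ^ 2) := by
  set M := ∑ x ∈ Ω, z ^ X x with hM
  set μ := (∑ x ∈ Ω, X x * z ^ X x) / M with hμ
  have hMpos : 0 < M := Finset.sum_pos (fun x _ => pow_pos hz _) hΩ
  have hμM : μ * M = ∑ x ∈ Ω, X x * z ^ X x := div_mul_cancel₀ _ hMpos.ne'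
  have hμ0 : 0 ≤ μ := div_nonneg (Finset.sum_nonneg fun x _ => by positivity) hMpos.le
  have hμn : μ ≤ n := by
    rw [hμ, div_le_iff₀ hMpos, hM, Finset.mul_sum]
    exact Finset.sum_le_sum fun x hx =>
      mul_le_mul_of_nonneg_right (by exact_mod_cast hX x hx) (by positivity)
  have hpt : ∀ x ∈ Ω, (z * Real.exp t) ^ X x
      ≤ Real.exp (t * μ) * ((1 + t ^ 2 * n ^ 2 - t * μ) * z ^ X x + t * (X x * z ^ X x)) := by
    intro x hx
    have hXn : (X x : ℝ) ≤ n := by exact_mod_cast hX x hx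
    have hX0 : (0 : ℝ) ≤ X x := Nat.cast_nonneg _
    have habs : |(X x : ℝ) - μ| ≤ n := abs_le.2 ⟨by linarith, by linarith⟩
    have hu : |t * (X x - μ)| ≤ 1 := by
      rw [abs_mul]
      exact (mul_le_mul_of_nonneg_left habs (abs_nonneg t)).trans ht
    have h1 := (abs_le.1 (Real.abs_exp_sub_one_sub_id_le hu)).2
    have h2 : (t * (X x - μ)) ^ 2 ≤ t ^ 2 * n ^ 2 := by
      rw [mul_pow]
      exact mul_le_mul_of_nonneg_left (sq_le_sq' (abs_le.1 habs).1 (abs_le.1 habs).2) (sq_nonneg t)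
    have h3 : (z * Real.exp t) ^ X x = Real.exp (t * μ) * (Real.exp (t * (X x - μ)) * z ^ X x) := by
      rw [mul_pow, ← Real.exp_nat_mul, ← mul_assoc, ← Real.exp_add, mul_comm]
      congr 2; ring
    rw [h3]
    refine mul_le_mul_of_nonneg_left ?_ (Real.exp_pos _).le
    have h4 : Real.exp (t * (X x - μ)) ≤ 1 + t ^ 2 * n ^ 2 - t * μ + t * X x := by linarith
    calc _ ≤ (1 + t ^ 2 * n ^ 2 - t * μ + t * X x) * z ^ X x :=
          mul_le_mul_of_nonneg_right h4 (by positivity)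
      _ = _ := by ring
  refine (Finset.sum_le_sum hpt).trans ?_
  rw [← Finset.mul_sum, Finset.sum_add_distrib, ← Finset.mul_sum, ← Finset.mul_sum, ← hM, ← hμM,
    Real.exp_add]
  have : 1 + t ^ 2 * (n : ℝ) ^ 2 ≤ Real.exp (t ^ 2 * n ^ 2) := by
    linarith [Real.add_one_le_exp (t ^ 2 * (n : ℝ) ^ 2)]
  calc _ = Real.exp (t * μ) * M * (1 + t ^ 2 * n ^ 2) := by ring
    _ ≤ Real.exp (t * μ) * M * Real.exp (t ^ 2 * n ^ 2) := by gcongr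
    _ = _ := by ring

/-- Lower bound for the number of low-weight elements of a set whose weight enumerator is a
product of weight enumerators of bounded degree. -/
lemma exists_le_card_filter_le {α β : Type} (G : Finset α) (Ω : α → Finset β) (L : Finset β)
    (X : β → ℕ) {n : ℕ} (hn : 1 ≤ n) (hX : ∀ g ∈ G, ∀ x ∈ Ω g, X x ≤ n)
    (h0 : ∀ g ∈ G, ∃ x ∈ Ω g, X x = 0)
    (hL : ∀ z : ℝ, ∑ x ∈ L, z ^ X x = ∏ g ∈ G, ∑ x ∈ Ω g, z ^ X x)
    {m ω ε : ℝ} (hω : 0 ≤ ω) (hε : 0 < ε) (hε1 : ε ≤ 1) (hGm : G.card ≤ m) (hm : 0 < m)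
    (hlarge : Real.exp (-(m * (ε ^ 2 / (4 * n ^ 2)))) ≤ 1 / 4) :
    ∃ z : ℝ, 0 < z ∧ z ≤ 1 ∧
      1 / 2 * z ^ (-(ω * m)) * ∏ g ∈ G, ∑ x ∈ Ω g, z ^ X x
        ≤ ((L.filter fun x => (X x : ℝ) ≤ (ω + 2 * ε) * m).card : ℝ) := by
  set T := (ω + ε) * m with hT
  set s := ε * m with hs
  have hTpos : 0 < T := by positivity
  have hspos : 0 < s := by positivity
  have hnR : (1 : ℝ) ≤ n := by exact_mod_cast hn
  set μ : ℝ → ℝ := fun z => ∑ g ∈ G, (∑ x ∈ Ω g, X x * z ^ X x) / ∑ x ∈ Ω g, z ^ X x with hμ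
  have hMg : ∀ g ∈ G, ∀ z : ℝ, 0 ≤ z → 0 < ∑ x ∈ Ω g, z ^ X x := by
    intro g hg z hz
    obtain ⟨x, hx, hx0⟩ := h0 g hg
    exact Finset.sum_pos' (fun y _ => by positivity) ⟨x, hx, by simp [hx0]⟩
  have hΩne : ∀ g ∈ G, (Ω g).Nonempty := fun g hg => (h0 g hg).imp fun x hx => hx.1
  have hμc : ContinuousOn μ (Set.Icc 0 1) := by
    refine continuousOn_finsetSum _ fun g hg => ContinuousOn.div (by fun_prop) (by fun_prop) ?_
    exact fun z hz => (hMg g hg z hz.1).ne'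
  have hμ0 : μ 0 = 0 := by
    refine Finset.sum_eq_zero fun g _ => ?_
    rw [Finset.sum_eq_zero, zero_div]
    intro x _
    rcases Nat.eq_zero_or_pos (X x) with h | h
    · simp [h]
    · simp [h.ne']
  obtain ⟨z, hz0, hz1, hzT, hz⟩ : ∃ z : ℝ, 0 < z ∧ z ≤ 1 ∧ μ z ≤ T ∧ (z = 1 ∨ μ z = T) := by
    by_cases h : μ 1 ≤ T
    · exact ⟨1, one_pos, le_rfl, h, Or.inl rfl⟩
    · obtain ⟨z, hz, hzT⟩ := intermediate_value_Icc zero_le_one hμc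
        (show T ∈ Set.Icc (μ 0) (μ 1) from ⟨hμ0.trans_le hTpos.le, (not_le.1 h).le⟩)
      refine ⟨z, hz.1.lt_of_ne ?_, hz.2, hzT.le, Or.inr hzT⟩
      rintro rfl
      exact hTpos.ne (hμ0.symm.trans hzT)
  refine ⟨z, hz0, hz1, ?_⟩
  rw [← hL]
  set M := ∑ x ∈ L, z ^ X x with hM
  have hMnn : 0 ≤ M := Finset.sum_nonneg fun x _ => by positivity
  set t := ε / (2 * (n : ℝ) ^ 2) with ht
  have htpos : 0 < t := by positivity
  have htn : t * n ≤ 1 := by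
    rw [ht, div_mul_eq_mul_div, div_le_one (by positivity)]
    nlinarith
  have hexp : ∀ u : ℝ, |u| * n ≤ 1 →
      ∑ x ∈ L, (z * Real.exp u) ^ X x ≤ M * Real.exp (u * μ z + u ^ 2 * n ^ 2 * m) := by
    intro u hu
    rw [hL, hM, hL]
    calc _ ≤ ∏ g ∈ G, ((∑ x ∈ Ω g, z ^ X x) * Real.exp
          (u * ((∑ x ∈ Ω g, X x * z ^ X x) / ∑ x ∈ Ω g, z ^ X x) + u ^ 2 * n ^ 2)) :=
          Finset.prod_le_prod (fun g _ => Finset.sum_nonneg fun x _ => by positivity)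
            fun g hg => sum_pow_mul_exp_le _ _ (hX g hg) hz0 (hΩne g hg) hu
      _ = (∏ g ∈ G, ∑ x ∈ Ω g, z ^ X x) * Real.exp (u * μ z + u ^ 2 * n ^ 2 * G.card) := by
          rw [Finset.prod_mul_distrib, ← Real.exp_sum, Finset.sum_add_distrib, ← Finset.mul_sum,
            Finset.sum_const, nsmul_eq_mul, mul_comm (G.card : ℝ)]
      _ ≤ _ := by
          have : 0 ≤ ∏ g ∈ G, ∑ x ∈ Ω g, z ^ X x :=
            Finset.prod_nonneg fun g _ => Finset.sum_nonneg fun x _ => by positivity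
          refine mul_le_mul_of_nonneg_left (Real.exp_le_exp.2 ?_) this
          have : u ^ 2 * (n : ℝ) ^ 2 * G.card ≤ u ^ 2 * (n : ℝ) ^ 2 * m :=
            mul_le_mul_of_nonneg_left hGm (by positivity)
          linarith
  have htail : ∀ u : ℝ, |u| = t → u * (μ z - T) ≤ 0 →
      ∑ x ∈ L.filter (fun x => t * s ≤ u * (X x - T)), z ^ X x ≤ M / 4 := by
    intro u hu huT
    have hu2 : u ^ 2 = t ^ 2 := by rw [← sq_abs, hu]
    have h1 : ∑ x ∈ L.filter (fun x => t * s ≤ u * (X x - T)), z ^ X x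
        ≤ Real.exp (-(u * T) - t * s) * ∑ x ∈ L, (z * Real.exp u) ^ X x := by
      rw [Finset.mul_sum]
      refine (Finset.sum_le_sum (f := fun x => z ^ X x) fun x hx => ?_).trans
        (Finset.sum_le_sum_of_subset_of_nonneg (Finset.filter_subset _ _)
          fun x _ _ => by positivity)
      have hx := (Finset.mem_filter.1 hx).2
      rw [mul_pow, ← Real.exp_nat_mul, mul_left_comm, ← Real.exp_add]
      refine le_mul_of_one_le_right (by positivity) (Real.one_le_exp ?_)
      linarith
    refine h1.trans ?_
    calc _ ≤ Real.exp (-(u * T) - t * s) * (M * Real.exp (u * μ z + u ^ 2 * n ^ 2 * m)) := by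
          gcongr; exact hexp u (hu.symm ▸ htn)
      _ = M * Real.exp (u * (μ z - T) + (t ^ 2 * n ^ 2 * m - t * s)) := by
          rw [mul_left_comm, ← Real.exp_add, hu2]; congr 2; ring
      _ ≤ M * Real.exp (-(m * (ε ^ 2 / (4 * n ^ 2)))) := by
          gcongr
          have : t ^ 2 * n ^ 2 * m - t * s = -(m * (ε ^ 2 / (4 * n ^ 2))) := by
            rw [ht, hs]; field_simp; ring
          linarith
      _ ≤ M * (1 / 4) := by gcongr
      _ = M / 4 := by ring
  have hup := htail t (abs_of_pos htpos) (mul_nonpos_of_nonneg_of_nonpos htpos.le (by linarith))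
  set B := L.filter fun x => (X x : ℝ) ≤ (ω + 2 * ε) * m with hB
  have hTs : T + s = (ω + 2 * ε) * m := by rw [hT, hs]; ring
  have hTs' : T - s = ω * m := by rw [hT, hs]; ring
  have hsplit : M ≤ M / 4 + ∑ x ∈ B, z ^ X x := by
    refine (Finset.sum_filter_add_sum_filter_not L (fun x => t * s ≤ t * (X x - T)) _).ge.trans ?_
    refine add_le_add hup (Finset.sum_le_sum_of_subset_of_nonneg ?_ fun x _ _ => by positivity)
    intro x hx
    rw [Finset.mem_filter] at hx ⊢
    refine ⟨hx.1, ?_⟩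
    have := lt_of_mul_lt_mul_left (not_le.1 hx.2) htpos.le
    linarith
  rcases hz with rfl | hz
  · simp only [one_pow, Finset.sum_const, nsmul_eq_mul, mul_one, Real.one_rpow] at hsplit ⊢
    linarith
  · have hlow := htail (-t) (by rw [abs_neg, abs_of_pos htpos]) (by rw [hz]; simp)
    have hmid : ∀ x ∈ L.filter (fun x => ¬ t * s ≤ -t * (X x - T)),
        z ^ X x ≤ z ^ (ω * m) := by
      intro x hx
      have hx := (Finset.mem_filter.1 hx).2
      rw [← Real.rpow_natCast]
      refine Real.rpow_le_rpow_of_exponent_ge hz0 hz1 ?_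
      have : t * (T - X x) < t * s := by linarith
      have := lt_of_mul_lt_mul_left this htpos.le
      linarith
    have hsum : ∑ x ∈ B, z ^ X x ≤ M / 4 + B.card * z ^ (ω * m) := by
      rw [← Finset.sum_filter_add_sum_filter_not B (fun x => t * s ≤ -t * (X x - T))]
      refine add_le_add (le_trans ?_ hlow) ?_
      · exact Finset.sum_le_sum_of_subset_of_nonneg
          (Finset.filter_subset_filter _ (Finset.filter_subset _ _)) fun x _ _ => by positivity
      · calc _ ≤ ∑ x ∈ B.filter (fun x => ¬ t * s ≤ -t * (X x - T)), z ^ (ω * m) :=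
              Finset.sum_le_sum fun x hx => hmid x
                (Finset.filter_subset_filter _ (Finset.filter_subset _ _) hx)
          _ ≤ _ := by
              rw [Finset.sum_const, nsmul_eq_mul]
              gcongr
              exact Finset.filter_subset _ _
    have hfin : M / 2 ≤ B.card * z ^ (ω * m) := by linarith
    have hzz : z ^ (-(ω * m)) * z ^ (ω * m) = 1 := by
      rw [← Real.rpow_add hz0]; simp
    calc 1 / 2 * z ^ (-(ω * m)) * M = z ^ (-(ω * m)) * (M / 2) := by ring
      _ ≤ z ^ (-(ω * m)) * (B.card * z ^ (ω * m)) := by gcongr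
      _ = B.card * (z ^ (-(ω * m)) * z ^ (ω * m)) := by ring
      _ = B.card := by rw [hzz, mul_one]

end Tails

section Rates

lemma logb_weight_le {q m n : ℕ} (hq : 2 ≤ q) (hm : 1 ≤ m) (hmn : m ≤ n) {z : ℝ} (hz0 : 0 ≤ z)
    (hz1 : z ≤ 1) :
    (m : ℝ) / n * Real.logb q ((1 + ((q : ℝ) - 1) * z) ^ n + ((q : ℝ) - 1) * (1 - z) ^ n)
      ≤ Real.logb q ((1 + ((q : ℝ) - 1) * z) ^ m + ((q : ℝ) - 1) * (1 - z) ^ m) := by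
  have hqR : (2 : ℝ) ≤ q := by exact_mod_cast hq
  have hmR : (1 : ℝ) ≤ m := by exact_mod_cast hm
  have hmnR : (m : ℝ) ≤ n := by exact_mod_cast hmn
  have ha : (1 : ℝ) ≤ (q : ℝ) - 1 := by linarith
  set a := (q : ℝ) - 1
  have hA : 0 < 1 + a * z := by positivity
  have hB : 0 ≤ 1 - z := by linarith
  set A := 1 + a * z
  set B := 1 - z
  set p : ℝ := n / m with hp
  have hp1 : 1 ≤ p := by rw [hp, le_div_iff₀ (by linarith)]; linarith
  have hpow : ∀ x : ℝ, 0 ≤ x → (x ^ m) ^ p = x ^ n := by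
    intro x hx
    rw [← Real.rpow_natCast, ← Real.rpow_mul hx, hp, mul_div_cancel₀ _ (by positivity),
      Real.rpow_natCast]
  have h : A ^ n + a * B ^ n ≤ (A ^ m + a * B ^ m) ^ p := by
    calc A ^ n + a * B ^ n ≤ A ^ n + a ^ p * B ^ n := by
          gcongr
          simpa using Real.rpow_le_rpow_of_exponent_le ha hp1
      _ = (A ^ m) ^ p + (a * B ^ m) ^ p := by
          rw [Real.mul_rpow (by positivity) (by positivity), hpow A hA.le, hpow B hB]
      _ ≤ _ := Real.add_rpow_le_rpow_add (by positivity) (by positivity) hp1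
  have hlog := Real.logb_le_logb_of_le (b := q) (by linarith) (by positivity) h
  rw [Real.logb_rpow_eq_mul_logb_of_pos (by positivity)] at hlog
  calc _ ≤ (m : ℝ) / n * (p * Real.logb q (A ^ m + a * B ^ m)) := by gcongr
    _ = _ := by
      have : (n : ℝ) ≠ 0 := by linarith
      rw [hp]; field_simp

lemma le_R0 {q n : ℕ} (hq : 2 ≤ q) {ω : ℝ} (hω : 0 ≤ ω) (hn : 1 ≤ n) {z : ℝ}
    (hz0 : 0 < z) (hz1 : z ≤ 1) :
    ω * Real.logb q z + 1
        - 1 / n * Real.logb q ((1 + ((q : ℝ) - 1) * z) ^ n + ((q : ℝ) - 1) * (1 - z) ^ n)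
      ≤ R0 q ω n := by
  have hqR : (2 : ℝ) ≤ q := by exact_mod_cast hq
  have hnR : (1 : ℝ) ≤ n := by exact_mod_cast hn
  have hbdd : BddBelow (Set.range fun z : Set.Ioc (0 : ℝ) 1 =>
      (-ω * Real.logb q (z : ℝ) - 1 / n + (1 / n) *
        Real.logb q ((1 + ((q : ℝ) - 1) * (z : ℝ)) ^ n + ((q : ℝ) - 1) * (1 - (z : ℝ)) ^ n))) := by
    refine ⟨-1 / n, ?_⟩
    rintro _ ⟨⟨y, hy0, hy1⟩, rfl⟩
    have h1 : Real.logb q y ≤ 0 := Real.logb_nonpos (by linarith) hy0.le hy1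
    have h2 : 0 ≤ Real.logb q ((1 + ((q : ℝ) - 1) * y) ^ n + ((q : ℝ) - 1) * (1 - y) ^ n) := by
      refine Real.logb_nonneg (by linarith) ?_
      have h3 : 1 ≤ (1 + ((q : ℝ) - 1) * y) ^ n := one_le_pow₀ (by nlinarith)
      have h4 : 0 ≤ ((q : ℝ) - 1) * (1 - y) ^ n :=
        mul_nonneg (by linarith) (pow_nonneg (by linarith) n)
      linarith
    have h5 : 0 ≤ (1 / (n : ℝ)) *
        Real.logb q ((1 + ((q : ℝ) - 1) * y) ^ n + ((q : ℝ) - 1) * (1 - y) ^ n) := by positivity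
    simp only
    rw [neg_div]
    nlinarith
  have h := ciInf_le hbdd ⟨z, hz0, hz1⟩
  have hn' : ((n : ℝ) - 1) / n = 1 - 1 / n := by field_simp
  rw [R0, lambdaQ, hn']
  simp only at h
  linarith

lemma R0_nonneg {q n : ℕ} (hq : 2 ≤ q) {ω : ℝ} (hω : 0 ≤ ω) (hn : 1 ≤ n) : 0 ≤ R0 q ω n := by
  have hqR : (2 : ℝ) ≤ q := by exact_mod_cast hq
  have hnR : (1 : ℝ) ≤ n := by exact_mod_cast hn
  refine le_trans (le_of_eq ?_) (le_R0 hq hω hn one_pos le_rfl)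
  rw [mul_one, sub_self, zero_pow (by omega), mul_zero, add_zero, add_sub_cancel, Real.logb_one,
    Real.logb_pow, Real.logb_self_eq_one (by linarith)]
  field_simp
  ring

lemma le_R0_zero {q n : ℕ} (hq : 2 ≤ q) (hn : 1 ≤ n) : 1 - 1 / (n : ℝ) ≤ R0 q 0 n := by
  have hqR : (2 : ℝ) ≤ q := by exact_mod_cast hq
  set f : ℝ → ℝ := fun z => 1
        - 1 / n * Real.logb q ((1 + ((q : ℝ) - 1) * z) ^ n + ((q : ℝ) - 1) * (1 - z) ^ n) with hf
  have hf0 : f 0 = 1 - 1 / n := by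
    simp [hf, Real.logb_self_eq_one (show (1 : ℝ) < q by linarith)]
  have hc : ContinuousAt f 0 := by
    refine continuousAt_const.sub (continuousAt_const.mul ?_)
    refine ContinuousAt.div_const (ContinuousAt.log (by fun_prop) ?_) _
    simp; linarith
  have ht : Tendsto f (nhdsWithin 0 (Set.Ioi 0)) (nhds (1 - 1 / n)) :=
    hf0 ▸ hc.tendsto.mono_left nhdsWithin_le_nhds
  refine le_of_tendsto ht ?_
  filter_upwards [Ioc_mem_nhdsGT (zero_lt_one (α := ℝ))] with z hz
  have := le_R0 hq le_rfl hn hz.1 hz.2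
  simpa [hf] using this

variable {K ι : Type} [Field K] [Fintype K] [DecidableEq K] [Fintype ι] [DecidableEq ι]

lemma card_productCode {G : Finset (Finset ι)} (hG : (G : Set (Finset ι)).PairwiseDisjoint id)
    {d : Finset ι → ι → K} (hd : ∀ g ∈ G, ∃ i ∈ g, d g i ≠ 0) :
    Real.logb (Fintype.card K) (productCode G d).card = ∑ g ∈ G, ((g.card : ℝ) - 1) := by
  have hqR : (1 : ℝ) < Fintype.card K := by exact_mod_cast Fintype.one_lt_card (α := K)
  have h := sum_productCode hG d 1
  simp only [one_pow, Finset.sum_const, nsmul_eq_mul, mul_one] at h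
  rw [h, Real.logb_prod]
  · refine Finset.sum_congr rfl fun g hg => ?_
    obtain ⟨i, hi, hdi⟩ := hd g hg
    rw [card_parityCode hi hdi, Real.logb_pow, Real.logb_self_eq_one hqR, mul_one,
      Nat.cast_sub (Finset.card_pos.2 ⟨i, hi⟩), Nat.cast_one]
  · intro g hg
    obtain ⟨i, hi, hdi⟩ := hd g hg
    rw [card_parityCode hi hdi]
    positivity

/-- The index of a Hamming ball in a product of parity-check codes is bounded by means of `R0`. -/
lemma logb_card_productCode_le {G : Finset (Finset ι)}
    (hG : (G : Set (Finset ι)).PairwiseDisjoint id) {n : ℕ} (hn : 1 ≤ n)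
    (hGn : ∀ g ∈ G, g.card ≤ n) {d : Finset ι → ι → K} (hd : ∀ g ∈ G, ∃ i ∈ g, d g i ≠ 0)
    {m : ℕ} (hm : ∑ g ∈ G, g.card = m) (hm0 : 0 < m) {ω ε : ℝ} (hω : 0 ≤ ω) (hε : 0 < ε)
    (hε1 : ε ≤ 1) (hlarge : Real.exp (-(m * (ε ^ 2 / (4 * n ^ 2)))) ≤ 1 / 4) :
    Real.logb (Fintype.card K) (productCode G d).card ≤
      Real.logb (Fintype.card K)
        ((productCode G d).filter fun x => (hammingNorm x : ℝ) ≤ (ω + 2 * ε) * m).card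
        + 1 + m * R0 (Fintype.card K) ω n := by
  have hq : 2 ≤ Fintype.card K := Fintype.one_lt_card
  have hqR : (2 : ℝ) ≤ Fintype.card K := by exact_mod_cast hq
  have hnR : (1 : ℝ) ≤ n := by exact_mod_cast hn
  have hcard : ∀ g ∈ G, 1 ≤ g.card := fun g hg =>
    Finset.card_pos.2 ((hd g hg).imp fun i hi => hi.1)
  have hGm : (G.card : ℝ) ≤ m := by
    rw [← hm, Finset.card_eq_sum_ones]
    exact_mod_cast Finset.sum_le_sum hcard
  obtain ⟨z, hz0, hz1, hz⟩ := exists_le_card_filter_le G (fun g => parityCode g (d g))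
    (productCode G d) hammingNorm hn
    (fun g hg x hx => (hammingNorm_le_of_mem_parityCode hx).trans (hGn g hg))
    (fun g _ => ⟨0, by simp [parityCode], by simp⟩) (sum_productCode hG d) hω hε hε1 hGm
    (by exact_mod_cast hm0) hlarge
  have hR := le_R0 hq hω hn hz0 hz1
  set q := Fintype.card K with hqdef
  set W := Real.logb q ((1 + ((q : ℝ) - 1) * z) ^ n + ((q : ℝ) - 1) * (1 - z) ^ n) with hW
  have hMpos : ∀ g ∈ G, 0 < ∑ x ∈ parityCode g (d g), z ^ hammingNorm x := fun g _ =>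
    Finset.sum_pos (fun x _ => by positivity) ⟨0, by simp [parityCode]⟩
  have hMlog : ∀ g ∈ G, (g.card : ℝ) / n * W - 1
      ≤ Real.logb q (∑ x ∈ parityCode g (d g), z ^ hammingNorm x) := by
    intro g hg
    have h1 := logb_weight_le hq (hcard g hg) (hGn g hg) hz0.le hz1
    have hA : 0 < (1 + ((q : ℝ) - 1) * z) ^ g.card + ((q : ℝ) - 1) * (1 - z) ^ g.card := by
      have h3 : 0 < (1 + ((q : ℝ) - 1) * z) ^ g.card := pow_pos (by nlinarith) _
      have h4 : 0 ≤ ((q : ℝ) - 1) * (1 - z) ^ g.card :=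
        mul_nonneg (by linarith) (pow_nonneg (by linarith) _)
      linarith
    have h2 := Real.logb_le_logb_of_le (b := q) (by linarith) hA
      (le_sum_parityCode g (d g) hz0.le hz1)
    rw [Real.logb_mul (by positivity) (hMpos g hg).ne', Real.logb_self_eq_one (by linarith)] at h2
    linarith
  have hprod : 0 < ∏ g ∈ G, ∑ x ∈ parityCode g (d g), z ^ hammingNorm x :=
    Finset.prod_pos hMpos
  have hzpow : 0 < z ^ (-(ω * m)) := Real.rpow_pos_of_pos hz0 _
  have hB := Real.logb_le_logb_of_le (b := q) (by linarith)
    (mul_pos (mul_pos one_half_pos hzpow) hprod) hz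
  rw [Real.logb_mul (mul_pos one_half_pos hzpow).ne' hprod.ne',
    Real.logb_mul one_half_pos.ne' hzpow.ne',
    Real.logb_rpow_eq_mul_logb_of_pos hz0, Real.logb_prod _ _ fun g hg => (hMpos g hg).ne',
    one_div, Real.logb_inv] at hB
  have h2 : Real.logb q 2 ≤ 1 := by
    rw [← Real.logb_self_eq_one (b := (q : ℝ)) (by linarith)]
    exact Real.logb_le_logb_of_le (by linarith) (by norm_num) hqR
  have hsum := Finset.sum_le_sum hMlog
  rw [Finset.sum_sub_distrib, ← Finset.sum_mul, ← Finset.sum_div] at hsum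
  rw [card_productCode hG hd, Finset.sum_sub_distrib]
  have hmR : ∑ g ∈ G, (g.card : ℝ) = m := by exact_mod_cast hm
  rw [hmR] at hsum ⊢
  have hR' := mul_le_mul_of_nonneg_left hR (Nat.cast_nonneg (α := ℝ) m)
  have e : (m : ℝ) / n * W = m * (1 / n * W) := by ring
  rw [e] at hsum
  linarith

end Rates

section Puncturing

lemma minDist_le {K ι : Type} [Fintype ι] [DecidableEq K] {C : Set (ι → K)} {c c' : ι → K}
    (hc : c ∈ C) (hc' : c' ∈ C) (h : c ≠ c') : minDist C ≤ hammingDist c c' :=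
  Nat.sInf_le ⟨c, hc, c', hc', h, rfl⟩

lemma le_minDist {K ι : Type} [Fintype ι] [DecidableEq K] {C : Set (ι → K)} (hC : C.Nontrivial)
    {x : ℝ} (h : ∀ c ∈ C, ∀ c' ∈ C, c ≠ c' → x ≤ hammingDist c c') : x ≤ minDist C := by
  obtain ⟨c, hc, c', hc', hne⟩ := hC
  obtain ⟨a, ha, b, hb, hab, he⟩ : minDist C ∈
      {d : ℕ | ∃ c ∈ C, ∃ c' ∈ C, c ≠ c' ∧ hammingDist c c' = d} :=
    Nat.sInf_mem ⟨_, c, hc, c', hc', hne, rfl⟩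
  rw [← he]
  exact h a ha b hb hab

variable {K : Type} [Field K] {N n : ℕ} {C : Set (Fin N → K)} {Rg : Fin N → Finset (Fin N)}

lemma IsAllDisjoint.pairwiseDisjoint (hR : IsAllDisjoint Rg) :
    ((Finset.univ.image Rg : Finset (Finset (Fin N))) : Set (Finset (Fin N))).PairwiseDisjoint
      id := by
  intro g hg h hh hne
  simp only [Finset.coe_image, Finset.coe_univ, Set.image_univ, Set.mem_range] at hg hh
  obtain ⟨j, rfl⟩ := hg
  obtain ⟨j', rfl⟩ := hh
  exact (hR j j').resolve_left hne

lemma IsLinRecLRC.exists_parity (hC : IsLinRecLRC C n Rg) :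
    ∃ d : Finset (Fin N) → Fin N → K, ∀ g ∈ Finset.univ.image Rg,
      (∃ i ∈ g, d g i ≠ 0) ∧ ∀ c ∈ C, ∑ i ∈ g, d g i * c i = 0 := by
  have h : ∀ g : Finset (Fin N), ∃ d : Fin N → K, g ∈ Finset.univ.image Rg →
      (∃ i ∈ g, d i ≠ 0) ∧ ∀ c ∈ C, ∑ i ∈ g, d i * c i = 0 := by
    intro g
    by_cases hg : g ∈ Finset.univ.image Rg
    · obtain ⟨j, -, rfl⟩ := Finset.mem_image.1 hg
      obtain ⟨hj, -, a, ha, hac⟩ := hC j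
      refine ⟨a - Pi.single j 1, fun _ => ⟨⟨j, hj, by simp [ha j]⟩, fun c hc => ?_⟩⟩
      have h1 : ∑ i ∈ Rg j, a i * c i = c j := by
        rw [hac c hc]
        refine Finset.sum_subset (Finset.subset_univ _) fun i _ hi => ?_
        rw [ha i fun h => hi (Finset.mem_of_mem_erase h), zero_mul]
      have h2 : ∑ i ∈ Rg j, (Pi.single j 1 : Fin N → K) i * c i = c j := by
        simp [Pi.single_apply, hj]
      simp only [Pi.sub_apply, sub_mul, Finset.sum_sub_distrib, h1, h2, sub_self]
    · exact ⟨0, fun h => absurd h hg⟩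
  choose d hd using h
  exact ⟨d, hd⟩

lemma exists_groups_card_near (hC : IsLinRecLRC C n Rg) {T : ℝ} (hT0 : 0 ≤ T) (hTN : T ≤ N) :
    ∃ G ⊆ Finset.univ.image Rg, T - n ≤ ((G.biUnion id).card : ℝ) ∧
      ((G.biUnion id).card : ℝ) ≤ T := by
  set S := (Finset.univ.image Rg).powerset.filter fun G => ((G.biUnion id).card : ℝ) ≤ T with hS
  obtain ⟨G, hGS, hmax⟩ := Finset.exists_max_image S (fun G => (G.biUnion id).card)
    ⟨∅, by simp [hS, hT0]⟩
  rw [hS, Finset.mem_filter, Finset.mem_powerset] at hGS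
  refine ⟨G, hGS.1, ?_, hGS.2⟩
  by_contra hlt
  have hne : ∃ j, j ∉ G.biUnion id := by
    by_contra hall
    push Not at hall
    have : G.biUnion id = Finset.univ := Finset.eq_univ_of_forall hall
    rw [this, Finset.card_univ, Fintype.card_fin] at hlt
    linarith [Nat.cast_nonneg (α := ℝ) n]
  obtain ⟨j, hj⟩ := hne
  have hcard : (((insert (Rg j) G).biUnion id).card : ℝ) ≤ n + (G.biUnion id).card := by
    rw [Finset.biUnion_insert]
    have h1 := Finset.card_union_le (id (Rg j)) (G.biUnion id)
    have h2 : (id (Rg j)).card ≤ n := (hC j).2.1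
    exact_mod_cast h1.trans (by omega)
  have hmem : insert (Rg j) G ∈ S := by
    rw [hS, Finset.mem_filter, Finset.mem_powerset, Finset.insert_subset_iff]
    refine ⟨⟨Finset.mem_image_of_mem _ (Finset.mem_univ _), hGS.1⟩, ?_⟩
    linarith
  refine absurd (hmax _ hmem) (not_le.2 (Finset.card_lt_card ?_))
  refine Finset.ssubset_iff_of_subset
    (Finset.biUnion_subset_biUnion_of_subset_left _ (Finset.subset_insert _ _)) |>.2 ⟨j, ?_, hj⟩
  rw [Finset.biUnion_insert]
  exact Finset.mem_union_left _ (hC j).1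

/-- Restricting a locally repairable code to a union of its repair groups. -/
lemma IsLinRecLRC.restrict (hC : IsLinRecLRC C n Rg) (hR : IsAllDisjoint Rg) {N' : ℕ}
    (f : Fin N' ↪ Fin N) (hf : ∀ k, ∀ i ∈ Rg (f k), i ∈ Set.range f) {D : Set (Fin N → K)}
    (hD : D ⊆ C) :
    ∃ Rg' : Fin N' → Finset (Fin N'),
      IsLinRecLRC ((fun c : Fin N → K => c ∘ f) '' D) n Rg' ∧ IsAllDisjoint Rg' := by
  classical
  refine ⟨fun k => Finset.univ.filter fun i => f i ∈ Rg (f k), fun k => ?_, fun k k' => ?_⟩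
  · obtain ⟨hj, hcard, a, ha, hac⟩ := hC (f k)
    refine ⟨by simpa using hj, le_trans ?_ hcard, fun i => a (f i), fun i hi => ?_, ?_⟩
    · rw [← Finset.card_map f]
      refine Finset.card_le_card fun i hi => ?_
      obtain ⟨k', hk', rfl⟩ := Finset.mem_map.1 hi
      exact (Finset.mem_filter.1 hk').2
    · refine ha _ fun h => hi ?_
      rw [Finset.mem_erase] at h ⊢
      exact ⟨fun e => h.1 (e ▸ rfl), by simpa using h.2⟩
    · rintro _ ⟨c, hc, rfl⟩
      simp only [Function.comp_apply]
      rw [hac c (hD hc), ← Finset.sum_map Finset.univ f fun i => a i * c i]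
      refine (Finset.sum_subset (Finset.subset_univ _) fun i _ hi => ?_).symm
      rw [ha i fun h => hi ?_, zero_mul]
      obtain ⟨k', hk'⟩ := hf k i (Finset.mem_of_mem_erase h)
      exact Finset.mem_map.2 ⟨k', Finset.mem_univ _, hk'⟩
  · rcases hR (f k) (f k') with h | h
    · left; simp only [h]
    · right
      rw [Finset.disjoint_left] at h ⊢
      intro i hi hi'
      exact h (Finset.mem_filter.1 hi).2 (Finset.mem_filter.1 hi').2

end Puncturing

section Translates

variable {K ι : Type} [Field K] [Fintype K] [DecidableEq K] [Fintype ι] [DecidableEq ι]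

lemma sub_mem_productCode {G : Finset (Finset ι)} {d : Finset ι → ι → K} {x y : ι → K}
    (hx : x ∈ productCode G d) (hy : y ∈ productCode G d) : x - y ∈ productCode G d := by
  simp only [productCode, Finset.mem_filter, Finset.mem_univ, true_and] at hx hy ⊢
  refine ⟨fun i hi => by simp [hx.1 i hi, hy.1 i hi], fun g hg => ?_⟩
  simp only [Pi.sub_apply, mul_sub, Finset.sum_sub_distrib, hx.2 g hg, hy.2 g hg, sub_self]

/-- Some translate of a subset `B` of `L` contains at least the average number of codewords. -/
lemma exists_translate {G : Finset (Finset ι)} {d : Finset ι → ι → K} {α : Type} (C : Finset α)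
    {p : α → ι → K} (hp : ∀ c ∈ C, p c ∈ productCode G d) {B : Finset (ι → K)}
    (hB : B ⊆ productCode G d) :
    ∃ v ∈ productCode G d,
      C.card * B.card ≤ (productCode G d).card * (C.filter fun c => p c - v ∈ B).card := by
  set L := productCode G d with hL
  refine Finset.exists_le_of_sum_le (s := L) ⟨0, by simp [hL, productCode]⟩ ?_
  rw [Finset.sum_const, ← Finset.mul_sum, smul_eq_mul]
  refine Nat.mul_le_mul_left _ (le_of_eq ?_)
  have h := Finset.sum_card_bipartiteAbove_eq_sum_card_bipartiteBelow (s := L) (t := C)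
    fun v c => p c - v ∈ B
  simp only [Finset.bipartiteAbove, Finset.bipartiteBelow] at h
  rw [h, ← smul_eq_mul, ← Finset.sum_const]
  refine Finset.sum_congr rfl fun c hc => ?_
  refine Finset.card_nbij' (fun b => p c - b) (fun v => p c - v) ?_ ?_ ?_ ?_
  · intro b hb
    have : b ∈ B := hb
    simp only [Finset.coe_filter, Set.mem_ofPred_eq, sub_sub_cancel]
    exact ⟨sub_mem_productCode (hp c hc) (hB hb), this⟩
  · intro v hv
    exact (Finset.mem_filter.1 hv).2
  · intro b _; simp
  · intro v _; simp

end Translates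

section Shortening

lemma hammingDist_eq_add {K : Type} [Field K] [DecidableEq K] {N : ℕ} (J : Finset (Fin N))
    {N' : ℕ} (f : Fin N' ↪ Fin N)
    (hf : Set.range f = ((Jᶜ : Finset (Fin N)) : Set (Fin N))) (c c' : Fin N → K) :
    hammingDist c c' = hammingDist (fun i => if i ∈ J then c i else 0)
      (fun i => if i ∈ J then c' i else 0) + hammingDist (c ∘ f) (c' ∘ f) := by
  unfold hammingDist
  rw [← Finset.card_filter_add_card_filter_not (s := Finset.univ.filter fun i => c i ≠ c' i)
    (· ∈ J), ← Finset.card_map f]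
  congr 2
  · ext i; by_cases h : i ∈ J <;> simp [h]
  · ext i
    have hi : i ∉ J ↔ i ∈ Set.range f := by simp [hf]
    simp only [Finset.mem_filter, Finset.mem_univ, true_and, hi, Finset.mem_map, Set.mem_range,
      Function.comp_apply]
    constructor
    · rintro ⟨h, k, rfl⟩; exact ⟨k, h, rfl⟩
    · rintro ⟨k, h, rfl⟩; exact ⟨h, k, rfl⟩

variable {K : Type} [Field K] [Fintype K] [DecidableEq K] {N n : ℕ} {C : Set (Fin N → K)}
  {Rg : Fin N → Finset (Fin N)}

lemma IsLinRecLRC.logb_ncard_le (hC : IsLinRecLRC C n Rg) (hR : IsAllDisjoint Rg)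
    (hne : C.Nonempty) (hn : 1 ≤ n) :
    Real.logb (Fintype.card K) C.ncard ≤ (1 - 1 / (n : ℝ)) * N := by
  classical
  have hq : (1 : ℝ) < Fintype.card K := by exact_mod_cast Fintype.one_lt_card (α := K)
  have hnR : (1 : ℝ) ≤ n := by exact_mod_cast hn
  obtain ⟨d, hd⟩ := hC.exists_parity
  set G := Finset.univ.image Rg with hG
  have hsub : C ⊆ (productCode G d : Finset (Fin N → K)) := by
    intro c hc
    simp only [productCode, Finset.coe_filter, Finset.mem_univ, true_and, Set.mem_ofPred_eq]
    exact ⟨fun i hi => absurd (hC i).1 (hi _ (by simp [hG])), fun g hg => (hd g hg).2 c hc⟩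
  have hcard : C.ncard ≤ (productCode G d).card := by
    rw [← Set.ncard_coe_finset]; exact Set.ncard_le_ncard hsub (Finset.finite_toSet _)
  have hpos : (0 : ℝ) < C.ncard := by
    exact_mod_cast (Set.ncard_pos (Set.toFinite C)).2 hne
  refine (Real.logb_le_logb_of_le hq hpos (Nat.cast_le.2 hcard)).trans ?_
  rw [card_productCode hR.pairwiseDisjoint fun g hg => (hd g hg).1]
  have hU : G.biUnion id = Finset.univ :=
    Finset.eq_univ_of_forall fun j => Finset.mem_biUnion.2 ⟨Rg j, by simp [hG], (hC j).1⟩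
  have hsum : ∑ g ∈ G, (g.card : ℝ) = N := by
    have := Finset.card_biUnion (s := G) (t := id) hR.pairwiseDisjoint
    rw [hU, Finset.card_univ, Fintype.card_fin] at this
    exact_mod_cast this.symm
  rw [← hsum, Finset.mul_sum]
  refine Finset.sum_le_sum fun g hg => ?_
  obtain ⟨j, -, rfl⟩ := Finset.mem_image.1 hg
  have : ((Rg j).card : ℝ) ≤ n := by exact_mod_cast (hC j).2.1
  have : 1 / (n : ℝ) * (Rg j).card ≤ 1 := by
    rw [one_div, inv_mul_le_iff₀ (by linarith)]; linarith
  linarith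

/-- Shortening: the subcode of the words lying, on a union of repair groups, in a common Hamming
ball, punctured at these repair groups. -/
lemma IsLinRecLRC.exists_shortening (hC : IsLinRecLRC C n Rg) (hR : IsAllDisjoint Rg)
    (hne : C.Nonempty) (hn : 1 ≤ n) {τ θ ε : ℝ} (hτ0 : 0 ≤ τ) (hτ1 : τ ≤ 1) (hθ : 0 ≤ θ)
    (hε : 0 < ε) (hε1 : ε ≤ 1) (hpos : 0 < τ * N - n)
    (hlarge : Real.exp (-((τ * N - n) * (ε ^ 2 / (4 * n ^ 2)))) ≤ 1 / 4)
    (hd : (θ + 4 * ε) * (τ * N) < minDist C) :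
    ∃ (N' : ℕ) (C' : Set (Fin N' → K)), C'.Nonempty ∧
      (∃ Rg' : Fin N' → Finset (Fin N'), IsLinRecLRC C' n Rg' ∧ IsAllDisjoint Rg') ∧
      (1 - τ) * N ≤ N' ∧ N' ≤ (1 - τ) * N + n ∧
      Real.logb (Fintype.card K) C.ncard
        ≤ 1 + τ * N * R0 (Fintype.card K) (θ / 2) n + Real.logb (Fintype.card K) C'.ncard ∧
      (C'.Nontrivial → minDist C - (θ + 4 * ε) * (τ * N) ≤ minDist C') := by
  classical
  have hq : 2 ≤ Fintype.card K := Fintype.one_lt_card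
  have hqR : (1 : ℝ) < Fintype.card K := by exact_mod_cast hq
  obtain ⟨d, hdpar⟩ := hC.exists_parity
  obtain ⟨G, hGsub, hGlo, hGhi⟩ := exists_groups_card_near hC (T := τ * N) (by positivity)
    (mul_le_of_le_one_left (Nat.cast_nonneg _) hτ1)
  set J := G.biUnion id with hJ
  have hGdisj : (G : Set (Finset (Fin N))).PairwiseDisjoint id :=
    hR.pairwiseDisjoint.subset (by exact_mod_cast hGsub)
  have hJcard : ∑ g ∈ G, g.card = J.card := (Finset.card_biUnion hGdisj).symm
  have hJpos : 0 < J.card := by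
    have : (0 : ℝ) < J.card := by linarith
    exact_mod_cast this
  have hball := logb_card_productCode_le hGdisj hn
    (fun g hg => by
      obtain ⟨j, -, rfl⟩ := Finset.mem_image.1 (hGsub hg)
      exact (hC j).2.1)
    (fun g hg => (hdpar g (hGsub hg)).1) hJcard hJpos (div_nonneg hθ zero_le_two) hε hε1
    (le_trans (Real.exp_le_exp.2 (by gcongr)) hlarge)
  set L := productCode G d with hL
  set B := L.filter fun x => (hammingNorm x : ℝ) ≤ (θ / 2 + 2 * ε) * J.card with hB
  have hBpos : (0 : ℝ) < B.card := by
    have : 0 < B.card := Finset.card_pos.2 ⟨0, by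
      rw [hB, Finset.mem_filter, hammingNorm_zero]
      exact ⟨by simp [hL, productCode], by push_cast; positivity⟩⟩
    exact_mod_cast this
  set p : (Fin N → K) → Fin N → K := fun c i => if i ∈ J then c i else 0 with hp
  have hpL : ∀ c ∈ (Set.toFinite C).toFinset, p c ∈ L := by
    intro c hc
    rw [Set.Finite.mem_toFinset] at hc
    simp only [hL, productCode, Finset.mem_filter, Finset.mem_univ, true_and]
    refine ⟨fun i hi => if_neg fun h => ?_, fun g hg => ?_⟩
    · obtain ⟨g, hg, hig⟩ := Finset.mem_biUnion.1 h
      exact hi g hg hig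
    · rw [← (hdpar g (hGsub hg)).2 c hc]
      refine Finset.sum_congr rfl fun i hi => ?_
      rw [hp]
      simp only
      rw [if_pos (Finset.mem_biUnion.2 ⟨g, hg, hi⟩)]
  obtain ⟨v, -, hv⟩ := exists_translate _ hpL (Finset.filter_subset _ _ : B ⊆ L)
  set D := (Set.toFinite C).toFinset.filter fun c => p c - v ∈ B with hD
  have hDC : (D : Set (Fin N → K)) ⊆ C := by
    intro c hc
    exact (Set.Finite.mem_toFinset _).1 (Finset.mem_filter.1 hc).1
  have hCcard : (Set.toFinite C).toFinset.card = C.ncard := (Set.ncard_eq_toFinset_card C).symm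
  rw [hCcard] at hv
  have hCpos : (0 : ℝ) < C.ncard := by
    exact_mod_cast (Set.ncard_pos (Set.toFinite C)).2 hne
  have hvR : (C.ncard : ℝ) * B.card ≤ L.card * D.card := by exact_mod_cast hv
  have hprod : (0 : ℝ) < L.card * D.card := (mul_pos hCpos hBpos).trans_le hvR
  have hLne : (L.card : ℝ) ≠ 0 := left_ne_zero_of_mul hprod.ne'
  have hDne : (D.card : ℝ) ≠ 0 := right_ne_zero_of_mul hprod.ne'
  have hclose : ∀ c ∈ D, ∀ c' ∈ D,
      (hammingDist (p c) (p c') : ℝ) ≤ (θ + 4 * ε) * (τ * N) := by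
    intro c hc c' hc'
    have h1 := (Finset.mem_filter.1 (Finset.mem_filter.1 hc).2).2
    have h2 := (Finset.mem_filter.1 (Finset.mem_filter.1 hc').2).2
    rw [← neg_add_eq_sub, ← hammingDist_eq_hammingNorm] at h1 h2
    have h3 : (hammingDist (p c) (p c') : ℝ) ≤ hammingDist v (p c) + hammingDist v (p c') := by
      exact_mod_cast hammingDist_triangle_left (p c) (p c') v
    calc _ ≤ (θ + 4 * ε) * J.card := by linarith
      _ ≤ _ := by gcongr
  set f : Fin (Jᶜ.card) ↪ Fin N := (Jᶜ.orderEmbOfFin rfl).toEmbedding with hf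
  have hfr : Set.range f = ((Jᶜ : Finset (Fin N)) : Set (Fin N)) :=
    Finset.range_orderEmbOfFin _ rfl
  have hdist : ∀ c ∈ D, ∀ c' ∈ D, c ≠ c' →
      minDist C - (θ + 4 * ε) * (τ * N) ≤ hammingDist (c ∘ f) (c' ∘ f) := by
    intro c hc c' hc' hcc
    have h1 : (minDist C : ℝ) ≤ hammingDist c c' := by
      exact_mod_cast minDist_le (hDC hc) (hDC hc') hcc
    rw [hammingDist_eq_add J f hfr c c'] at h1
    push_cast at h1
    linarith [hclose c hc c' hc']
  have hinj : Set.InjOn (fun c : Fin N → K => c ∘ f) (D : Set (Fin N → K)) := by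
    intro c hc c' hc' h
    by_contra hcc
    have h1 := hdist c hc c' hc' hcc
    simp only at h
    rw [h, hammingDist_self, Nat.cast_zero] at h1
    linarith
  have hncard : ((fun c : Fin N → K => c ∘ f) '' (D : Set (Fin N → K))).ncard = D.card := by
    rw [hinj.ncard_image, Set.ncard_coe_finset]
  have hJc : (Jᶜ.card : ℝ) = N - J.card := by
    rw [Finset.card_compl, Fintype.card_fin, Nat.cast_sub]
    simpa using Finset.card_le_univ J
  refine ⟨Jᶜ.card, (fun c : Fin N → K => c ∘ f) '' (D : Set (Fin N → K)), ?_, ?_, ?_, ?_, ?_, ?_⟩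
  · refine Set.Nonempty.image _ ?_
    exact Finset.card_pos.1 (Nat.pos_of_ne_zero (by exact_mod_cast hDne))
  · refine hC.restrict hR f (fun k i hi => ?_) hDC
    rw [hfr, Finset.mem_coe, Finset.mem_compl]
    intro hiJ
    obtain ⟨g, hg, hig⟩ := Finset.mem_biUnion.1 hiJ
    have hfk : f k ∉ J := by
      have : f k ∈ Set.range f := ⟨k, rfl⟩
      rw [hfr] at this
      simpa using this
    refine hfk (Finset.mem_biUnion.2 ⟨g, hg, ?_⟩)
    obtain ⟨j, -, rfl⟩ := Finset.mem_image.1 (hGsub hg)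
    rcases hR (f k) j with h | h
    · exact h ▸ (hC (f k)).1
    · exact absurd hig (Finset.disjoint_left.1 h hi)
  · linarith
  · linarith
  · rw [hncard]
    have hlog := Real.logb_le_logb_of_le hqR (mul_pos hCpos hBpos) hvR
    rw [Real.logb_mul hCpos.ne' hBpos.ne', Real.logb_mul hLne hDne] at hlog
    have := mul_le_mul_of_nonneg_right hGhi (R0_nonneg hq (div_nonneg hθ zero_le_two) hn)
    linarith
  · intro hnt
    refine le_minDist hnt ?_
    rintro _ ⟨c, hc, rfl⟩ _ ⟨c', hc', rfl⟩ hcc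
    exact hdist c hc c' hc' fun h => hcc (h ▸ rfl)

end Shortening

section Sequences

variable {K : Type} [Field K] [Fintype K] [DecidableEq K]

/-- `R` bounds the rate of every all-disjoint linearly recoverable `(δ,n)`-LRC sequence. -/
def IsRateBound (K : Type) [Field K] [Fintype K] [DecidableEq K] (n : ℕ) (δ R : ℝ) : Prop :=
  ∀ (N : ℕ → ℕ) (C : ∀ i : ℕ, Set (Fin (N i) → K)),
    StrictMono N → (∀ i, (C i).Nonempty) →
    (∀ i, ∃ Rg : Fin (N i) → Finset (Fin (N i)), IsLinRecLRC (C i) n Rg ∧ IsAllDisjoint Rg) →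
    δ ≤ liminf (fun i => (minDist (C i) : ℝ) / (N i : ℝ)) atTop →
    limsup (fun i => Real.logb (Fintype.card K) ((C i).ncard : ℝ) / (N i : ℝ)) atTop ≤ R

lemma minDist_le_card {K ι : Type} [DecidableEq K] [Fintype ι] (C : Set (ι → K)) :
    minDist C ≤ Fintype.card ι := by
  rcases Set.eq_empty_or_nonempty {d : ℕ | ∃ c ∈ C, ∃ c' ∈ C, c ≠ c' ∧ hammingDist c c' = d}
    with h | ⟨_, c, hc, c', hc', hne, rfl⟩
  · simp [minDist, h]
  · exact (minDist_le hc hc' hne).trans hammingDist_le_card_fintype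

lemma minDist_div_le_one {K : Type} [DecidableEq K] {N : ℕ} (C : Set (Fin N → K)) :
    (minDist C : ℝ) / N ≤ 1 :=
  div_le_one_of_le₀ (by simpa using minDist_le_card C) (Nat.cast_nonneg _)

lemma logb_ncard_div_nonneg {K : Type} [Field K] [Fintype K] {N : ℕ} {C : Set (Fin N → K)} (hC : C.Nonempty) :
    0 ≤ Real.logb (Fintype.card K) C.ncard / N := by
  have hq : (1 : ℝ) < Fintype.card K := by exact_mod_cast Fintype.one_lt_card (α := K)
  have : (1 : ℝ) ≤ C.ncard := by exact_mod_cast (Set.ncard_pos (Set.toFinite C)).2 hC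
  exact div_nonneg (Real.logb_nonneg hq this) (Nat.cast_nonneg _)

lemma logb_ncard_div_le {n N : ℕ} (hn : 1 ≤ n) {C : Set (Fin N → K)} (hne : C.Nonempty)
    (hC : ∃ Rg : Fin N → Finset (Fin N), IsLinRecLRC C n Rg ∧ IsAllDisjoint Rg) :
    Real.logb (Fintype.card K) C.ncard / N ≤ 1 - 1 / n := by
  obtain ⟨Rg, hC, hR⟩ := hC
  have hnR : (1 : ℝ) ≤ n := by exact_mod_cast hn
  refine div_le_of_le_mul₀ (Nat.cast_nonneg _) ?_ (hC.logb_ncard_le hR hne hn)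
  rw [sub_nonneg, div_le_one (by linarith)]
  exact hnR

lemma IsRateBound.le_of_exists {n : ℕ} (hn : 1 ≤ n) {δ R x : ℝ} (hR : IsRateBound K n δ R)
    (h : ∀ ε > 0, ∀ m : ℕ, ∃ N ≥ m, ∃ C : Set (Fin N → K), C.Nonempty ∧
      (∃ Rg : Fin N → Finset (Fin N), IsLinRecLRC C n Rg ∧ IsAllDisjoint Rg) ∧
      δ - ε ≤ (minDist C : ℝ) / N ∧ x ≤ Real.logb (Fintype.card K) C.ncard / N) :
    x ≤ R := by
  obtain ⟨N, hN, hP⟩ := extraction_forall_of_frequently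
    (P := fun k N => ∃ C : Set (Fin N → K), C.Nonempty ∧
      (∃ Rg : Fin N → Finset (Fin N), IsLinRecLRC C n Rg ∧ IsAllDisjoint Rg) ∧
      δ - 1 / ((k : ℝ) + 1) ≤ (minDist C : ℝ) / N ∧
      x ≤ Real.logb (Fintype.card K) C.ncard / N)
    fun k => frequently_atTop.2 fun m => h _ Nat.one_div_pos_of_nat m
  choose C hne hLRC hdist hrate using hP
  refine le_trans ?_ (hR N C hN hne hLRC ?_)
  · refine le_limsup_of_frequently_le (Eventually.of_forall hrate).frequently ?_
    exact isBoundedUnder_of ⟨_, fun i => logb_ncard_div_le hn (hne i) (hLRC i)⟩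
  · refine le_of_forall_pos_sub_le fun ε hε => ?_
    refine le_liminf_of_le
      (isBoundedUnder_of ⟨1, fun i => minDist_div_le_one (C i)⟩).isCoboundedUnder_ge ?_
    have ht := (tendsto_one_div_add_atTop_nhds_zero_nat (𝕜 := ℝ)).eventually (gt_mem_nhds hε)
    filter_upwards [ht] with k hk
    linarith [hdist k]

lemma IsRateBound.nonneg {n : ℕ} (hn : 2 ≤ n) {δ R : ℝ} (hδ : δ ≤ 1) (hR : IsRateBound K n δ R) :
    0 ≤ R := by
  refine hR.le_of_exists (by omega) fun ε hε m => ?_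
  set σ : Fin (2 * (m + 1)) → Fin (2 * (m + 1)) := fun j =>
    ⟨if (j : ℕ) % 2 = 0 then j + 1 else j - 1, by have := j.2; split_ifs <;> omega⟩ with hσ
  have hσσ : ∀ j, σ (σ j) = j := by
    intro j
    ext
    simp only [hσ]
    split_ifs <;> omega
  have hσne : ∀ j, σ j ≠ j := by
    intro j h
    have := congrArg Fin.val h
    simp only [hσ] at this
    split_ifs at this <;> omega
  have hne : (0 : Fin (2 * (m + 1)) → K) ≠ 1 := fun h => zero_ne_one (congrFun h ⟨0, by omega⟩)
  refine ⟨2 * (m + 1), by omega, {0, 1}, ⟨0, by simp⟩, ⟨fun j => {j, σ j}, fun j => ?_,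
    fun j j' => ?_⟩, ?_, logb_ncard_div_nonneg ⟨0, by simp⟩⟩
  · refine ⟨by simp, Finset.card_le_two.trans hn, Pi.single (σ j) 1, fun i hi => ?_, ?_⟩
    · refine Pi.single_eq_of_ne ?_ _
      rintro rfl
      exact hi (by simp [hσne j])
    · intro c hc
      have : c j = c (σ j) := by rcases hc with rfl | rfl <;> rfl
      simp [Pi.single_apply, this]
  · by_cases h : j = j' ∨ j = σ j'
    · left
      rcases h with rfl | rfl
      · rfl
      · simp only [hσσ]
        rw [Finset.pair_comm]
    · right
      push Not at h
      have h1 : σ j ≠ j' := fun e => h.2 (by rw [← e, hσσ])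
      have h2 : σ j ≠ σ j' := fun e => h.1 (by rw [← hσσ j, e, hσσ])
      simp [Finset.disjoint_left, h.1, h.2, h1, h2]
  · have hN : (0 : ℝ) < ((2 * (m + 1) : ℕ) : ℝ) := by positivity
    rw [le_div_iff₀ hN]
    refine le_minDist ⟨0, by simp, 1, by simp, hne⟩ ?_
    have hd : hammingDist (0 : Fin (2 * (m + 1)) → K) 1 = 2 * (m + 1) := by
      simp [hammingDist]
    have hle : (δ - ε) * ((2 * (m + 1) : ℕ) : ℝ) ≤ ((2 * (m + 1) : ℕ) : ℝ) :=
      mul_le_of_le_one_left hN.le (by linarith)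
    rintro c (rfl | rfl) c' (rfl | rfl) hcc
    · exact absurd rfl hcc
    · rwa [hd]
    · rwa [hammingDist_comm, hd]
    · exact absurd rfl hcc

/-- The enhanced bound when the part of the distance outside the shortened coordinates is
positive. -/
lemma IsRateBound.limsup_le {n : ℕ} (hn : 2 ≤ n) {τ θ θ' δ R : ℝ} (hτ0 : 0 < τ) (hτ1 : τ < 1)
    (hθ : 0 ≤ θ) (hθ' : θ' ≤ 1) (hR : IsRateBound K n θ' R)
    (hcombo : τ * θ + (1 - τ) * θ' ≤ δ) (hlt : τ * θ < δ)
    {N : ℕ → ℕ} {C : ∀ i : ℕ, Set (Fin (N i) → K)} (hmono : StrictMono N)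
    (hne : ∀ i, (C i).Nonempty)
    (hLRC : ∀ i, ∃ Rg : Fin (N i) → Finset (Fin (N i)),
      IsLinRecLRC (C i) n Rg ∧ IsAllDisjoint Rg)
    (hdist : δ ≤ liminf (fun i => (minDist (C i) : ℝ) / (N i : ℝ)) atTop) :
    limsup (fun i => Real.logb (Fintype.card K) ((C i).ncard : ℝ) / (N i : ℝ)) atTop
      ≤ τ * R0 (Fintype.card K) (θ / 2) n + (1 - τ) * R := by
  have hR0 : 0 ≤ R := hR.nonneg hn hθ'
  have hq : (1 : ℝ) < Fintype.card K := by exact_mod_cast Fintype.one_lt_card (α := K)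
  set r := R0 (Fintype.card K) (θ / 2) n with hr
  by_contra hcon
  obtain ⟨y, hy1, hy2⟩ := exists_between (not_le.1 hcon)
  set η := y - (τ * r + (1 - τ) * R) with hη
  have hηpos : 0 < η := by linarith
  have hfreq : ∃ᶠ i in atTop,
      y < Real.logb (Fintype.card K) ((C i).ncard : ℝ) / (N i : ℝ) :=
    frequently_lt_of_lt_limsup (isBoundedUnder_of
      ⟨0, fun i => logb_ncard_div_nonneg (hne i)⟩).isCoboundedUnder_le hy2
  suffices h : R + η / 2 ≤ R by linarith
  refine hR.le_of_exists (by omega) fun ε hε m => ?_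
  obtain ⟨ε₁, hε₁, hε₁1, hε₁ε, hε₁δ⟩ : ∃ ε₁ : ℝ, 0 < ε₁ ∧ ε₁ ≤ 1 ∧ 10 * ε₁ ≤ ε * (1 - τ) ∧
      10 * ε₁ ≤ δ - τ * θ := by
    have h1 : 0 < ε * (1 - τ) := mul_pos hε (by linarith)
    have h2 : 0 < δ - τ * θ := by linarith
    refine ⟨min 1 (min (ε * (1 - τ) / 10) ((δ - τ * θ) / 10)), by positivity, min_le_left _ _, ?_, ?_⟩
    · have := (min_le_right 1 (min (ε * (1 - τ) / 10) ((δ - τ * θ) / 10))).trans (min_le_left _ _)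
      linarith
    · have := (min_le_right 1 (min (ε * (1 - τ) / 10) ((δ - τ * θ) / 10))).trans (min_le_right _ _)
      linarith
  have hev1 : ∀ᶠ i in atTop, δ - ε₁ < (minDist (C i) : ℝ) / (N i : ℝ) :=
    eventually_lt_of_lt_liminf (by linarith)
      (isBoundedUnder_of ⟨0, fun i => by positivity⟩)
  have hN : Tendsto (fun i => (N i : ℝ)) atTop atTop :=
    tendsto_natCast_atTop_atTop.comp hmono.tendsto_atTop
  have hlarge : ∀ᶠ i in atTop,
      Real.exp (-((τ * N i - n) * (ε₁ ^ 2 / (4 * n ^ 2)))) ≤ 1 / 4 := by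
    have ht : Tendsto (fun i => (τ * N i - n) * (ε₁ ^ 2 / (4 * n ^ 2))) atTop atTop :=
      ((tendsto_atTop_add_const_right _ (-(n : ℝ)) (hN.const_mul_atTop hτ0)).atTop_mul_const
        (by positivity))
    exact (Real.tendsto_exp_neg_atTop_nhds_zero.comp ht).eventually
      (ge_mem_nhds (by norm_num))
  obtain ⟨i, hyi, hdi, hexp, hN1, hN2, hN3, hN4, hN5⟩ := (hfreq.and_eventually
    (hev1.and (hlarge.and ((hN.eventually_gt_atTop (n / τ)).and
      ((hN.eventually_gt_atTop (m / (1 - τ))).and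
      ((hN.eventually_ge_atTop (2 * ((R + η / 2) * n + 1) / η)).and
      ((hN.eventually_ge_atTop (2 * n / (ε * (1 - τ)))).and
      (hN.eventually_gt_atTop 0)))))))).exists
  have h1τ : 0 < 1 - τ := by linarith
  rw [div_lt_iff₀ hτ0] at hN1
  rw [div_lt_iff₀ h1τ] at hN2
  rw [div_le_iff₀ hηpos] at hN3
  rw [div_le_iff₀ (by positivity)] at hN4
  rw [lt_div_iff₀ hN5] at hyi hdi
  obtain ⟨Rg, hC, hRg⟩ := hLRC i
  have hdi' : (θ + 4 * ε₁) * (τ * N i) + ((1 - τ) * θ' - 5 * ε₁) * N i ≤ minDist (C i) := by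
    have : (θ + 4 * ε₁) * τ + ((1 - τ) * θ' - 5 * ε₁) ≤ δ - ε₁ := by nlinarith
    nlinarith
  obtain ⟨N', C', hne', hLRC', hlo, hhi, hlog, hmin⟩ := hC.exists_shortening hRg (hne i) (by omega)
    hτ0.le hτ1.le hθ hε₁ hε₁1 (by linarith) hexp (by
      have : (θ + 4 * ε₁) * τ < δ - ε₁ := by nlinarith
      nlinarith)
  have hlogC : N i * ((1 - τ) * R + η) - 1 ≤ Real.logb (Fintype.card K) C'.ncard := by
    have : y = τ * r + (1 - τ) * R + η := by rw [hη]; ring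
    rw [this] at hyi
    rw [← hr] at hlog
    linarith
  have hN'pos : (0 : ℝ) < N' := lt_of_lt_of_le (by positivity) hlo
  have hlogN' : (R + η / 2) * N' ≤ Real.logb (Fintype.card K) C'.ncard := by
    have h1 := mul_le_mul_of_nonneg_left hhi (show 0 ≤ R + η / 2 by positivity)
    have h2 : 0 ≤ τ * (η * N i) := by positivity
    linarith
  have hnt : C'.Nontrivial := by
    by_contra hnt
    have hsub := Set.not_nontrivial_iff.1 hnt
    have hone : C'.ncard ≤ 1 := Set.ncard_le_one_iff_subsingleton.2 hsub
    have hzero : Real.logb (Fintype.card K) C'.ncard ≤ 0 :=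
      Real.logb_nonpos hq (Nat.cast_nonneg _) (by exact_mod_cast hone)
    have : 0 < (R + η / 2) * N' := by positivity
    linarith
  refine ⟨N', ?_, C', hne', hLRC', ?_, ?_⟩
  · have : (m : ℝ) ≤ N' := by linarith
    exact_mod_cast this
  · rcases le_or_gt (θ' - ε) 0 with h | h
    · exact h.trans (by positivity)
    · rw [le_div_iff₀ hN'pos]
      refine le_trans ?_ (hmin hnt)
      have h1 := mul_le_mul_of_nonneg_left hhi h.le
      have h2 : (θ' - ε) * n ≤ n := mul_le_of_le_one_left (Nat.cast_nonneg _) (by linarith)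
      have h3 : 10 * ε₁ * N i ≤ ε * (1 - τ) * N i := mul_le_mul_of_nonneg_right hε₁ε hN5.le
      linarith
  · rwa [le_div_iff₀ hN'pos]

end Sequences

/-- Theorem 1 (bound enhancement): if `R_LRC(·,n)` bounds from above the rate of every
all-disjoint linearly recoverable `(δ',n)`-LRC sequence over `F`, for every
`δ' ∈ [0,(q-1)/q]`, then the rate of every all-disjoint linearly recoverable
`(δ,n)`-LRC sequence is also bounded from above by
`inf_{τ,θ,θ'} { τ·R_0(θ/2,n) + (1-τ)·R_LRC(θ',n) }`, the infimum being over
`τ ∈ (0,1)` and `(θ,θ') ∈ [0,(q-1)/q]²` with `τθ + (1-τ)θ' = δ`. -/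
theorem bound1_enhancement
    (K : Type) [Field K] [Fintype K] [DecidableEq K]
    (q : ℕ) (hq : Fintype.card K = q)
    (n : ℕ) (hn : 2 ≤ n)
    (δ : ℝ) (hδ : δ ∈ Set.Ico (0:ℝ) (((q:ℝ) - 1) / q))
    (RLRC : ℝ → ℝ)
    (hRLRC : ∀ δ' ∈ Set.Icc (0:ℝ) (((q:ℝ) - 1) / q),
      ∀ (N : ℕ → ℕ) (C : ∀ i : ℕ, Set (Fin (N i) → K)),
        StrictMono N → (∀ i, (C i).Nonempty) →
        (∀ i, ∃ Rg : Fin (N i) → Finset (Fin (N i)),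
          IsLinRecLRC (C i) n Rg ∧ IsAllDisjoint Rg) →
        δ' ≤ liminf (fun i => (minDist (C i) : ℝ) / (N i : ℝ)) atTop →
        limsup (fun i => Real.logb q ((C i).ncard : ℝ) / (N i : ℝ)) atTop ≤ RLRC δ')
    -- the given all-disjoint linearly recoverable `(δ,n)`-LRC sequence
    (N : ℕ → ℕ) (C : ∀ i : ℕ, Set (Fin (N i) → K))
    (hmono : StrictMono N) (hne : ∀ i, (C i).Nonempty)
    (hLRC : ∀ i, ∃ Rg : Fin (N i) → Finset (Fin (N i)),
      IsLinRecLRC (C i) n Rg ∧ IsAllDisjoint Rg)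
    (hdist : δ ≤ liminf (fun i => (minDist (C i) : ℝ) / (N i : ℝ)) atTop)
    -- an arbitrary admissible triple `(τ, θ, θ')`
    (τ θ θ' : ℝ) (hτ : τ ∈ Set.Ioo (0:ℝ) 1)
    (hθ : θ ∈ Set.Icc (0:ℝ) (((q:ℝ) - 1) / q))
    (hθ' : θ' ∈ Set.Icc (0:ℝ) (((q:ℝ) - 1) / q))
    (hcombo : τ * θ + (1 - τ) * θ' = δ) :
    limsup (fun i => Real.logb q ((C i).ncard : ℝ) / (N i : ℝ)) atTop
      ≤ τ * R0 q (θ / 2) n + (1 - τ) * RLRC θ' := by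
  subst hq
  obtain ⟨hτ0, hτ1⟩ := hτ
  have hB : IsRateBound K n θ' (RLRC θ') := hRLRC θ' hθ'
  have hq : (0 : ℝ) < Fintype.card K := by exact_mod_cast Fintype.card_pos (α := K)
  have hθ'1 : θ' ≤ 1 := hθ'.2.trans ((div_le_one hq).2 (by linarith))
  rcases hθ'.1.eq_or_lt with rfl | hθ'0
  · rcases hθ.1.eq_or_lt with rfl | hθ0
    · have hδ0 : δ = 0 := by rw [← hcombo]; ring
      have h1 := hB N C hmono hne hLRC (hδ0 ▸ hdist)
      have h2 : limsup (fun i => Real.logb (Fintype.card K) ((C i).ncard : ℝ) / (N i : ℝ)) atTop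
          ≤ 1 - 1 / n := limsup_le_of_le
        (isBoundedUnder_of ⟨0, fun i => logb_ncard_div_nonneg (hne i)⟩).isCoboundedUnder_le
        (Eventually.of_forall fun i => logb_ncard_div_le (by omega) (hne i) (hLRC i))
      have h3 := h2.trans (le_R0_zero (Fintype.one_lt_card (α := K)) (by omega))
      rw [zero_div]
      nlinarith
    · have ht : Tendsto (fun t : ℝ => t * R0 (Fintype.card K) (θ / 2) n + (1 - t) * RLRC 0)
          (nhdsWithin τ (Iio τ))
          (nhds (τ * R0 (Fintype.card K) (θ / 2) n + (1 - τ) * RLRC 0)) :=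
        (Continuous.tendsto (by fun_prop) τ).mono_left nhdsWithin_le_nhds
      refine ge_of_tendsto ht ?_
      filter_upwards [Ioo_mem_nhdsLT hτ0] with t ht
      have htlt : t * θ < τ * θ := mul_lt_mul_of_pos_right ht.2 hθ0
      exact hB.limsup_le hn ht.1 (ht.2.trans hτ1) hθ0.le zero_le_one (by linarith) (by linarith)
        hmono hne hLRC hdist
  · have := mul_pos (sub_pos.2 hτ1) hθ'0
    exact hB.limsup_le hn hτ0 hτ1 hθ.1 hθ'1 hcombo.le (by linarith) hmono hne hLRC hdist
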